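/- arXiv:1305.1036 — 3 statements merged into one kernel-verified Lean document; each statement's English description precedes it below -/
import Mathlib

section
/- For every fixed λ ∈ ℝ, the function ω ↦ log K(λ, ω) is strictly convex on (0, ∞). -/
open MeasureTheory Real

/-- The modified Bessel function of the third kind (Watson's integral representation). -/
noncomputable def besselK (lam ω : ℝ) : ℝ :=
  ∫ t in Set.Ioi (0 : ℝ), Real.exp (-ω * Real.cosh t) * Real.cosh (lam * t)

theorem integral_pos_of_ae_pos {α : Type*} [MeasurableSpace α] {μ : Measure α} [NeZero μ]
    {f : α → ℝ} (hf : Integrable f μ) (hpos : ∀ᵐ x ∂μ, 0 < f x) : 0 < ∫ x, f x ∂μ := by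
  have hnonneg : 0 ≤ᵐ[μ] f := hpos.mono fun x hx => hx.le
  refine (integral_nonneg_of_ae hnonneg).lt_of_ne fun h => ?_
  have hzero := (integral_eq_zero_iff_of_nonneg_ae hnonneg hf).1 h.symm
  obtain ⟨x, hx, hx'⟩ := (hpos.and hzero).exists
  exact hx.ne' hx'

theorem half_sq_le_cosh {t : ℝ} (ht : 0 ≤ t) : t ^ 2 / 2 ≤ 2 * cosh t := by
  have h₁ := quadratic_le_exp_of_nonneg ht
  have h₂ := exp_pos (-t)
  rw [cosh_eq]
  linarith

theorem cosh_le_exp_abs (x : ℝ) : cosh x ≤ exp |x| := by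
  have h₁ := exp_le_exp.2 (le_abs_self x)
  have h₂ := exp_le_exp.2 (neg_le_abs x)
  rw [cosh_eq]
  linarith

theorem besselK_integrableOn (lam : ℝ) {ω : ℝ} (hω : 0 < ω) :
    IntegrableOn (fun t => exp (-ω * cosh t) * cosh (lam * t)) (Set.Ioi 0) := by
  refine Integrable.mono' ((integrableOn_exp_neg_Ioi 0).const_mul (exp ((|lam| + 1) ^ 2 / ω)))
    (by fun_prop) ?_
  filter_upwards [self_mem_ae_restrict measurableSet_Ioi] with t ht
  have ht : 0 < t := ht
  rw [norm_of_nonneg (by positivity), ← exp_add]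
  refine (mul_le_mul_of_nonneg_left (cosh_le_exp_abs _) (exp_pos _).le).trans ?_
  rw [← exp_add, exp_le_exp, abs_mul, abs_of_pos ht]
  have hc := mul_le_mul_of_nonneg_left (half_sq_le_cosh ht.le) hω.le
  have hsq : (|lam| + 1) * t ≤ (|lam| + 1) ^ 2 / ω + ω * t ^ 2 / 4 := by
    have : (|lam| + 1) ^ 2 / ω + ω * t ^ 2 / 4 - (|lam| + 1) * t
        = ((|lam| + 1) - ω * t / 2) ^ 2 / ω := by
      field_simp
      ring
    have : 0 ≤ ((|lam| + 1) - ω * t / 2) ^ 2 / ω := by positivity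
    linarith
  linarith

theorem besselK_pos (lam : ℝ) {ω : ℝ} (hω : 0 < ω) : 0 < besselK lam ω :=
  have : NeZero (volume.restrict (Set.Ioi (0 : ℝ))) := ⟨by simp⟩
  integral_pos_of_ae_pos (besselK_integrableOn lam hω)
    (.of_forall fun _ => mul_pos (exp_pos _) (cosh_pos _))

/-- For fixed `λ`, the function `ω ↦ log K(λ, ω)` is strictly convex on `(0, ∞)`. -/
theorem besselK_strictConvexOn_argument (lam : ℝ) :
    StrictConvexOn ℝ (Set.Ioi (0 : ℝ)) (fun ω => Real.log (besselK lam ω)) := by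
  refine ⟨convex_Ioi 0, fun x hx y hy hxy a b ha hb hab => ?_⟩
  have hz : 0 < a * x + b * y := add_pos (mul_pos ha hx) (mul_pos hb hy)
  simp only [smul_eq_mul]
  have hKx := besselK_pos lam hx
  have hKy := besselK_pos lam hy
  have hKz := besselK_pos lam hz
  set α := log (besselK lam x) with hα
  set β := log (besselK lam y) with hβ
  have hIx := (besselK_integrableOn lam hx).const_mul (a * exp (-α))
  have hIy := (besselK_integrableOn lam hy).const_mul (b * exp (-β))
  have hIz := (besselK_integrableOn lam hz).const_mul (exp (-(a * α + b * β)))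
  have : NeZero (volume.restrict (Set.Ioi (0 : ℝ))) := ⟨by simp⟩
  have key := integral_pos_of_ae_pos ((hIx.add hIy).sub hIz) (by
    filter_upwards [self_mem_ae_restrict measurableSet_Ioi,
      ae_restrict_of_ae (Measure.ae_ne volume (arcosh ((α - β) / (y - x))))] with t ht hne
    have hpq : -x * cosh t - α ≠ -y * cosh t - β := fun h => hne <| by
      rw [← arcosh_cosh (le_of_lt ht)]
      congr 1
      rw [eq_div_iff (sub_ne_zero.2 hxy.symm)]
      linarith
    have hexp := mul_lt_mul_of_pos_right
      (strictConvexOn_exp.2 (Set.mem_univ _) (Set.mem_univ _) hpq ha hb hab)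
      (cosh_pos (lam * t))
    have hx' : exp (-x * cosh t - α) = exp (-α) * exp (-x * cosh t) := by
      rw [← exp_add]; ring_nf
    have hy' : exp (-y * cosh t - β) = exp (-β) * exp (-y * cosh t) := by
      rw [← exp_add]; ring_nf
    have hz' : exp (a * (-x * cosh t - α) + b * (-y * cosh t - β))
        = exp (-(a * α + b * β)) * exp (-(a * x + b * y) * cosh t) := by
      rw [← exp_add]; ring_nf
    simp only [smul_eq_mul] at hexp
    rw [hx', hy', hz'] at hexp
    simp only [Pi.sub_apply, Pi.add_apply]
    linarith)
  simp only [Pi.sub_apply, Pi.add_apply] at key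
  rw [integral_sub (by exact hIx.add hIy) hIz, integral_add hIx hIy, integral_const_mul,
    integral_const_mul, integral_const_mul] at key
  change 0 < a * exp (-α) * besselK lam x + b * exp (-β) * besselK lam y
    - exp (-(a * α + b * β)) * besselK lam (a * x + b * y) at key
  rw [exp_neg, exp_neg, exp_neg, hα, hβ, exp_log hKx, exp_log hKy, ← hα, ← hβ, mul_assoc,
    mul_assoc, inv_mul_cancel₀ hKx.ne', inv_mul_cancel₀ hKy.ne', mul_one, mul_one, hab, sub_pos,
    inv_mul_lt_one₀ (exp_pos _)] at key
  exact (log_lt_iff_lt_exp hKz).2 key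
end

section
/- For all ω > 0 and λ ∈ ℝ, K(λ, ω) ≤ √(π/(2ω)) · exp((λ² − 2ω²)/(2ω)). -/
open MeasureTheory Real

theorem Real.one_add_sq_div_two_le_cosh (t : ℝ) : 1 + t ^ 2 / 2 ≤ Real.cosh t := by
  have h : |t| / 2 ≤ Real.sinh (|t| / 2) := Real.self_le_sinh_iff.2 (by positivity)
  have hcosh : Real.cosh t = 1 + 2 * Real.sinh (|t| / 2) ^ 2 := by
    rw [← Real.cosh_abs t, show |t| = 2 * (|t| / 2) by ring, Real.cosh_two_mul, Real.cosh_sq]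
    ring_nf
  have hsq : (|t| / 2) ^ 2 ≤ Real.sinh (|t| / 2) ^ 2 := by gcongr
  rw [div_pow, sq_abs] at hsq
  linarith

theorem integrable_exp_neg_mul_sub_sq {b : ℝ} (hb : 0 < b) (a : ℝ) :
    Integrable fun t : ℝ => Real.exp (-b * (t - a) ^ 2) :=
  (integrable_exp_neg_mul_sq hb).comp_sub_right a

theorem integral_Ioi_exp_neg_mul_sub_sq_add_exp_neg_mul_add_sq {b : ℝ} (hb : 0 < b) (a : ℝ) :
    ∫ t in Set.Ioi (0 : ℝ), (Real.exp (-b * (t - a) ^ 2) + Real.exp (-b * (t + a) ^ 2)) =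
      Real.sqrt (Real.pi / b) := by
  have hf := integrable_exp_neg_mul_sub_sq hb a
  have hf' : Integrable fun t : ℝ => Real.exp (-b * (t + a) ^ 2) := by
    simpa only [sub_neg_eq_add] using integrable_exp_neg_mul_sub_sq hb (-a)
  have hreflect : ∫ t in Set.Ioi (0 : ℝ), Real.exp (-b * (t + a) ^ 2) =
      ∫ t in Set.Iic (0 : ℝ), Real.exp (-b * (t - a) ^ 2) := by
    have h := integral_comp_neg_Ioi 0 fun t : ℝ => Real.exp (-b * (t - a) ^ 2)
    rw [neg_zero] at h
    rw [← h]
    congr 1 with t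
    ring_nf
  rw [integral_add hf.integrableOn hf'.integrableOn, hreflect, add_comm,
    intervalIntegral.integral_Iic_add_Ioi hf.integrableOn hf.integrableOn,
    integral_sub_right_eq_self (fun t : ℝ => Real.exp (-b * t ^ 2)) a, integral_gaussian]

theorem exp_neg_mul_one_add_sq_div_two_mul_cosh {ω : ℝ} (hω : ω ≠ 0) (lam t : ℝ) :
    Real.exp (-ω * (1 + t ^ 2 / 2)) * Real.cosh (lam * t) =
      Real.exp ((lam ^ 2 - 2 * ω ^ 2) / (2 * ω)) / 2 *
        (Real.exp (-(ω / 2) * (t - lam / ω) ^ 2) + Real.exp (-(ω / 2) * (t + lam / ω) ^ 2)) := by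
  rw [Real.cosh_eq, div_mul_eq_mul_div, mul_div_assoc', mul_add (Real.exp _) (Real.exp _),
    mul_add (Real.exp _) (Real.exp _)]
  simp only [← Real.exp_add]
  congr 3 <;> field_simp <;> ring

/-- The bound `K(λ, ω) ≤ √(π/(2ω)) exp((λ² − 2ω²)/(2ω))` for `ω > 0`. -/
theorem besselK_upper_bound (ω lam : ℝ) (hω : 0 < ω) :
    besselK lam ω ≤ Real.sqrt (Real.pi / (2 * ω))
      * Real.exp ((lam ^ 2 - 2 * ω ^ 2) / (2 * ω)) := by
  have hb : 0 < ω / 2 := half_pos hω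
  have hf : Integrable fun t : ℝ =>
      Real.exp (-ω * (1 + t ^ 2 / 2)) * Real.cosh (lam * t) := by
    simp_rw [exp_neg_mul_one_add_sq_div_two_mul_cosh hω.ne']
    refine ((integrable_exp_neg_mul_sub_sq hb _).add ?_).const_mul _
    simpa only [sub_neg_eq_add] using integrable_exp_neg_mul_sub_sq hb (-(lam / ω))
  have hsqrt : Real.sqrt (Real.pi / (ω / 2)) = 2 * Real.sqrt (Real.pi / (2 * ω)) := by
    rw [show Real.pi / (ω / 2) = 2 ^ 2 * (Real.pi / (2 * ω)) by ring,
      Real.sqrt_mul (by norm_num), Real.sqrt_sq (by norm_num)]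
  calc besselK lam ω
      ≤ ∫ t in Set.Ioi (0 : ℝ), Real.exp (-ω * (1 + t ^ 2 / 2)) * Real.cosh (lam * t) := by
        refine integral_mono_of_nonneg (.of_forall fun t => ?_) hf.integrableOn
          (.of_forall fun t => ?_)
        · exact mul_nonneg (Real.exp_pos _).le (Real.cosh_pos _).le
        · refine mul_le_mul_of_nonneg_right (Real.exp_le_exp.2 ?_) (Real.cosh_pos _).le
          exact mul_le_mul_of_nonpos_left (Real.one_add_sq_div_two_le_cosh t) (by linarith)
    _ = _ := by
        simp_rw [exp_neg_mul_one_add_sq_div_two_mul_cosh hω.ne']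
        rw [integral_const_mul, integral_Ioi_exp_neg_mul_sub_sq_add_exp_neg_mul_add_sq hb, hsqrt]
        ring
end

section
/- For every fixed ω > 0, the function f(λ) = log K(λ, ω) is twice differentiable on ℝ and satisfies 0 ≤ f''(λ) ≤ 1/ω for all λ ∈ ℝ. -/
open MeasureTheory Real

open ProbabilityTheory

/-- The finite measure on `ℝ` with density `exp (-ω * cosh t)`, whose moment-generating function
is `2 * besselK · ω`. -/
noncomputable def besselMeasure (ω : ℝ) : Measure ℝ :=
  volume.withDensity fun t => ENNReal.ofReal (Real.exp (-ω * Real.cosh t))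

theorem integrable_besselMeasure_iff {ω : ℝ} {g : ℝ → ℝ} :
    Integrable g (besselMeasure ω) ↔
      Integrable (fun t => Real.exp (-ω * Real.cosh t) * g t) := by
  unfold besselMeasure
  rw [integrable_withDensity_iff_integrable_smul' (by fun_prop) (by simp)]
  simp [ENNReal.toReal_ofReal (Real.exp_pos _).le]

theorem integral_besselMeasure (ω : ℝ) (g : ℝ → ℝ) :
    ∫ t, g t ∂(besselMeasure ω) = ∫ t, Real.exp (-ω * Real.cosh t) * g t := by
  unfold besselMeasure
  rw [integral_withDensity_eq_integral_toReal_smul (by fun_prop) (by simp)]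
  simp [ENNReal.toReal_ofReal (Real.exp_pos _).le]

theorem sq_div_four_le_cosh (t : ℝ) : t ^ 2 / 4 ≤ Real.cosh t := by
  rw [← Real.cosh_abs, Real.cosh_eq, ← sq_abs]
  have h := Real.quadratic_le_exp_of_nonneg (abs_nonneg t)
  linarith [Real.exp_pos (-|t|), abs_nonneg t]

theorem integrable_exp_neg_mul_cosh_mul_exp {ω : ℝ} (hω : 0 < ω) (lam : ℝ) :
    Integrable fun t => Real.exp (-ω * Real.cosh t) * Real.exp (lam * t) := by
  refine ((integrable_exp_neg_mul_sq (b := ω / 8) (by positivity)).const_mul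
    (Real.exp (2 * lam ^ 2 / ω))).mono' (by fun_prop) (.of_forall fun t => ?_)
  rw [Real.norm_of_nonneg (by positivity), ← Real.exp_add, ← Real.exp_add, Real.exp_le_exp]
  have h := mul_le_mul_of_nonneg_left (sq_div_four_le_cosh t) hω.le
  have h2 : 2 * lam ^ 2 / ω + -(ω / 8) * t ^ 2 - (-ω * (t ^ 2 / 4) + lam * t)
      = (ω * t - 4 * lam) ^ 2 / (8 * ω) := by
    field_simp
    ring
  have h3 : 0 ≤ (ω * t - 4 * lam) ^ 2 / (8 * ω) := by positivity
  linarith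

theorem integrableExpSet_besselMeasure {ω : ℝ} (hω : 0 < ω) :
    integrableExpSet id (besselMeasure ω) = Set.univ :=
  Set.eq_univ_of_forall fun lam =>
    integrable_besselMeasure_iff.2 (integrable_exp_neg_mul_cosh_mul_exp hω lam)

theorem mem_interior_integrableExpSet_besselMeasure {ω : ℝ} (hω : 0 < ω) (lam : ℝ) :
    lam ∈ interior (integrableExpSet id (besselMeasure ω)) := by
  simp [integrableExpSet_besselMeasure hω]

theorem besselMeasure_ne_zero {ω : ℝ} : besselMeasure ω ≠ 0 := by
  unfold besselMeasure
  rw [Ne, withDensity_eq_zero_iff (by fun_prop)]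
  intro h
  have h2 : ∀ᵐ _ : ℝ, False := by
    filter_upwards [h] with t ht
    simp [not_le.2 (Real.exp_pos _)] at ht
  simpa using ae_iff.1 h2

theorem mgf_besselMeasure {ω : ℝ} (hω : 0 < ω) (lam : ℝ) :
    mgf id (besselMeasure ω) lam = 2 * besselK lam ω := by
  have hpos := integrable_exp_neg_mul_cosh_mul_exp hω lam
  have hneg := integrable_exp_neg_mul_cosh_mul_exp hω (-lam)
  have hsymm : ∫ t, Real.exp (-ω * Real.cosh t) * Real.exp (-lam * t)
      = ∫ t, Real.exp (-ω * Real.cosh t) * Real.exp (lam * t) := by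
    rw [← integral_neg_eq_self]
    simp
  have habs := integral_comp_abs
    (f := fun t => Real.exp (-ω * Real.cosh t) * Real.cosh (lam * t))
  have hcosh (t : ℝ) : Real.exp (-ω * Real.cosh |t|) * Real.cosh (lam * |t|)
      = (Real.exp (-ω * Real.cosh t) * Real.exp (lam * t)
        + Real.exp (-ω * Real.cosh t) * Real.exp (-lam * t)) / 2 := by
    rw [Real.cosh_abs, ← Real.cosh_abs (lam * |t|), abs_mul, abs_abs, ← abs_mul, Real.cosh_abs,
      Real.cosh_eq (lam * t), neg_mul lam t]
    ring
  simp only [hcosh] at habs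
  rw [integral_div, integral_add hpos hneg, hsymm] at habs
  rw [besselK, ← habs, mgf, integral_besselMeasure]
  simp

theorem log_besselK_eq {ω : ℝ} (hω : 0 < ω) :
    (fun lam => Real.log (besselK lam ω))
      = fun lam => cgf id (besselMeasure ω) lam - Real.log 2 := by
  ext lam
  have hpos : 0 < mgf id (besselMeasure ω) lam := mgf_pos' besselMeasure_ne_zero
    (interior_subset (s := integrableExpSet _ _) (mem_interior_integrableExpSet_besselMeasure hω lam))
  rw [mgf_besselMeasure hω] at hpos
  rw [cgf, mgf_besselMeasure hω, Real.log_mul two_ne_zero (by linarith)]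
  ring

/-- Integration by parts against the derivative of the potential `ω * cosh t - lam * t`, compared
with the strong monotonicity of that derivative. -/
theorem mul_integral_sub_sq_mul_exp_le {ω : ℝ} (hω : 0 < ω) (lam : ℝ) :
    ω * ∫ t, (t - Real.arsinh (lam / ω)) ^ 2 * Real.exp (lam * t) ∂(besselMeasure ω)
      ≤ mgf id (besselMeasure ω) lam := by
  set a := Real.arsinh (lam / ω) with ha
  have hsa : ω * Real.sinh a = lam := by
    rw [ha, Real.sinh_arsinh]
    field_simp
  have hpow (n : ℕ) (v : ℝ) : Integrable (fun t => t ^ n * Real.exp (v * t)) (besselMeasure ω) :=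
    integrable_pow_mul_exp_of_mem_interior_integrableExpSet
      (mem_interior_integrableExpSet_besselMeasure hω v) n
  have hlin (v : ℝ) : Integrable (fun t => (t - a) * Real.exp (v * t)) (besselMeasure ω) := by
    refine ((hpow 1 v).sub ((hpow 0 v).const_mul a)).congr (.of_forall fun t => ?_)
    simp only [Pi.sub_apply]
    ring
  have hsq : Integrable (fun t => (t - a) ^ 2 * Real.exp (lam * t)) (besselMeasure ω) := by
    refine (((hpow 2 lam).sub ((hpow 1 lam).const_mul (2 * a))).add
      ((hpow 0 lam).const_mul (a ^ 2))).congr (.of_forall fun t => ?_)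
    simp only [Pi.sub_apply, Pi.add_apply]
    ring
  have hexp : Integrable (fun t => Real.exp (lam * t)) (besselMeasure ω) := by
    simpa using hpow 0 lam
  have hdrift : Integrable (fun t => (ω * Real.sinh t - lam) * (t - a) * Real.exp (lam * t))
      (besselMeasure ω) := by
    refine ((((hlin (lam + 1)).sub (hlin (lam - 1))).const_mul (ω / 2)).sub
      ((hlin lam).const_mul lam)).congr (.of_forall fun t => ?_)
    simp only [Pi.sub_apply]
    rw [Real.sinh_eq, show (lam + 1) * t = lam * t + t by ring,
      show (lam - 1) * t = lam * t + -t by ring, Real.exp_add, Real.exp_add]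
    ring
  have hparts : ∫ t, (Real.exp (lam * t) - (ω * Real.sinh t - lam) * (t - a) * Real.exp (lam * t))
      ∂(besselMeasure ω) = 0 := by
    rw [integral_besselMeasure]
    refine integral_eq_zero_of_hasDerivAt_of_integrable (fun t => ?_)
      (integrable_besselMeasure_iff.1 (hexp.sub hdrift)) (integrable_besselMeasure_iff.1 (hlin lam))
    have h1 : HasDerivAt (fun t => Real.exp (-ω * Real.cosh t)) _ t :=
      ((Real.hasDerivAt_cosh t).const_mul (-ω)).exp
    have h2 : HasDerivAt (fun t => Real.exp (lam * t)) _ t :=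
      ((hasDerivAt_id t).const_mul lam).exp
    convert! h1.mul (((hasDerivAt_id t).sub_const a).mul h2) using 1
    simp
    ring
  rw [integral_sub hexp hdrift, sub_eq_zero] at hparts
  rw [mgf, ← integral_const_mul]
  simp only [id]
  rw [hparts]
  refine integral_mono (hsq.const_mul ω) hdrift fun t => ?_
  have hmono : (t - a) ^ 2 ≤ (Real.sinh t - Real.sinh a) * (t - a) := by
    rcases le_total a t with h | h
    · nlinarith [Real.sinh_sub_id_strictMono.monotone h]
    · nlinarith [Real.sinh_sub_id_strictMono.monotone h]
  calc ω * ((t - a) ^ 2 * Real.exp (lam * t))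
      = ω * (t - a) ^ 2 * Real.exp (lam * t) := by ring
    _ ≤ ω * ((Real.sinh t - Real.sinh a) * (t - a)) * Real.exp (lam * t) := by gcongr
    _ = (ω * Real.sinh t - lam) * (t - a) * Real.exp (lam * t) := by rw [← hsa]; ring

/-- The second derivative of the cumulant-generating function, a variance, is at most the
normalized second moment about any point. -/
theorem iteratedDeriv_two_cgf_le {Ω : Type*} [MeasurableSpace Ω] {μ : Measure Ω} {X : Ω → ℝ}
    {v : ℝ} (hμ : μ ≠ 0) (h : v ∈ interior (integrableExpSet X μ)) (a : ℝ) :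
    iteratedDeriv 2 (cgf X μ) v
      ≤ (∫ x, (X x - a) ^ 2 * Real.exp (v * X x) ∂μ) / mgf X μ v := by
  have hM : 0 < mgf X μ v := mgf_pos' hμ (interior_subset (s := integrableExpSet X μ) h)
  have hpow (n : ℕ) := integrable_pow_mul_exp_of_mem_interior_integrableExpSet h n
  have h0 : Integrable (fun x => a ^ 2 * Real.exp (v * X x)) μ := by
    simpa using (hpow 0).const_mul (a ^ 2)
  have h1 : Integrable (fun x => 2 * a * (X x * Real.exp (v * X x))) μ := by
    simpa using (hpow 1).const_mul (2 * a)
  have hexpand : ∫ x, (X x - a) ^ 2 * Real.exp (v * X x) ∂μ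
      = ∫ x, X x ^ 2 * Real.exp (v * X x) ∂μ - 2 * a * ∫ x, X x * Real.exp (v * X x) ∂μ
        + a ^ 2 * mgf X μ v := by
    rw [mgf, ← integral_const_mul, ← integral_const_mul, ← integral_sub (hpow 2) h1,
      ← integral_add (by exact (hpow 2).sub h1) h0]
    congr with x
    ring
  rw [iteratedDeriv_two_cgf h, hexpand, deriv_cgf h, add_div, sub_div, mul_div_assoc,
    mul_div_cancel_right₀ _ hM.ne']
  nlinarith [sq_nonneg ((∫ x, X x * Real.exp (v * X x) ∂μ) / mgf X μ v - a)]

/-- For fixed `ω > 0`, `f(λ) = log K(λ, ω)` is twice differentiable on `ℝ` with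
`0 ≤ f''(λ) ≤ 1/ω` for all `λ`. -/
theorem besselK_log_second_deriv_bound (ω : ℝ) (hω : 0 < ω) :
    Differentiable ℝ (fun lam => Real.log (besselK lam ω)) ∧
    Differentiable ℝ (deriv (fun lam => Real.log (besselK lam ω))) ∧
    ∀ lam : ℝ,
      0 ≤ deriv (deriv (fun l => Real.log (besselK l ω))) lam ∧
      deriv (deriv (fun l => Real.log (besselK l ω))) lam ≤ 1 / ω := by
  have hmem := mem_interior_integrableExpSet_besselMeasure hω
  have hderiv : deriv (fun lam => Real.log (besselK lam ω)) = deriv (cgf id (besselMeasure ω)) := by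
    rw [log_besselK_eq hω]
    ext lam
    exact deriv_sub_const _
  rw [hderiv, log_besselK_eq hω]
  refine ⟨fun lam => (analyticAt_cgf (hmem lam)).differentiableAt.sub_const _,
    fun lam => (analyticAt_cgf (hmem lam)).deriv.differentiableAt, fun lam => ?_⟩
  rw [← iteratedDeriv_one (f := cgf id (besselMeasure ω)), ← iteratedDeriv_succ]
  have hM : 0 < mgf id (besselMeasure ω) lam :=
    mgf_pos' besselMeasure_ne_zero (interior_subset (s := integrableExpSet _ _) (hmem lam))
  constructor
  · rw [iteratedDeriv_two_cgf_eq_integral (hmem lam)]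
    exact div_nonneg (integral_nonneg fun t => by positivity) hM.le
  · refine (iteratedDeriv_two_cgf_le besselMeasure_ne_zero (hmem lam)
      (Real.arsinh (lam / ω))).trans ?_
    rw [div_le_div_iff₀ hM hω, one_mul, mul_comm]
    exact mul_integral_sub_sq_mul_exp_le hω lam
end
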